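/- Fix d ∈ ℕ and 0 < η ≤ 1/2. Let C(0) ⊆ C(1) ⊆ … ⊆ C(m) be an increasing sequence of collections in D_j such that for every 1 ≤ k ≤ m the pair (C(k-1), C(k) \ C(k-1)) is d-previsible, and let {C_i(0) : 1 ≤ i ≤ d} be an (η,d)-homogeneous colouring of C(0). Then there exists a sequence of colourings {C_i(k) : 1 ≤ i ≤ d}, 1 ≤ k ≤ m, such that for each k the colouring {C_i(k)} is an (η,d)-homogeneous colouring of C(k) and C_i(k-1) ⊆ C_i(k) for all 1 ≤ i ≤ d. (In particular, if the moves of Player A in the colouring game are restricted to d-previsible extensions, Player B can always respond with a consistent (η,d)-homogeneous colouring.) -/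

import Mathlib

/-- Encoding of dyadic intervals: an interval of `D_j` (the dyadic intervals of length
`2 ^ (-j)` in `[0,1]`) is encoded by its position `i < 2 ^ j`, representing
`[i / 2 ^ j, (i + 1) / 2 ^ j]`; a dyadic testing interval `L ∈ D` with `|L| ≥ 2 ^ (-j)` is
encoded by a scale `k ≤ j` and a position `m < 2 ^ k`, representing
`[m / 2 ^ k, (m + 1) / 2 ^ k]`.  For a collection `C ⊆ D_j`, `restrict j k m C` is the
subcollection `C ∩ L = {i ∈ C : i ⊆ L}` of elements of `C` contained in the testing
interval `L = [m / 2 ^ k, (m + 1) / 2 ^ k]`. -/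
def restrict (j k m : ℕ) (C : Finset ℕ) : Finset ℕ :=
  C.filter fun i => i / 2 ^ (j - k) = m

/-- `col` is a decomposition of `C` into `d` pairwise disjoint (possibly empty) classes. -/
def IsColouring (d : ℕ) (C : Finset ℕ) (col : Fin d → Finset ℕ) : Prop :=
  (∀ i, col i ⊆ C) ∧ (∀ i₁ i₂ : Fin d, i₁ ≠ i₂ → Disjoint (col i₁) (col i₂)) ∧
    ∀ x ∈ C, ∃ i, x ∈ col i

/-- `col` is an `(η, d)`-homogeneous colouring of `C ⊆ D_j`: it is a decomposition of `C`
into `d` pairwise disjoint classes such that for every dyadic testing interval `L` of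
length `≥ 2 ^ (-j)`, either `|C ∩ L| > d` and
`η * max_{1 ≤ i ≤ d} |C_i ∩ L| ≤ min_{1 ≤ i ≤ d} |C_i ∩ L|`, or else `|C ∩ L| ≤ d` and
`|C_i ∩ L| ≤ 1` for every `1 ≤ i ≤ d`. -/
def IsHomogeneous (j d : ℕ) (η : ℝ) (C : Finset ℕ) (col : Fin d → Finset ℕ) : Prop :=
  IsColouring d C col ∧
    ∀ k ≤ j, ∀ m < 2 ^ k,
      (d < (restrict j k m C).card ∧
        ∀ i₁ i₂ : Fin d,
          η * (restrict j k m (col i₁)).card ≤ ((restrict j k m (col i₂)).card : ℝ)) ∨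
      ((restrict j k m C).card ≤ d ∧ ∀ i : Fin d, (restrict j k m (col i)).card ≤ 1)

/-- The pair `(C, U)` of (disjoint) collections in `D_j` is `d`-previsible: for every dyadic
interval `L` of length `≥ 2 ^ (-(j - 1))` with immediate dyadic successors `L'`, `L''`
(the two halves of `L`, in either order), the conditions `|(C ∪ U) ∩ L'| < d` and
`|(C ∪ U) ∩ L''| ≥ d` imply `U ∩ L'' = ∅` or `C ∩ L'' = ∅`. -/
def Previsible (j d : ℕ) (C U : Finset ℕ) : Prop :=
  ∀ k, k + 1 ≤ j → ∀ m < 2 ^ k, ∀ m' m'' : ℕ,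
    (m' = 2 * m ∧ m'' = 2 * m + 1) ∨ (m' = 2 * m + 1 ∧ m'' = 2 * m) →
    (restrict j (k + 1) m' (C ∪ U)).card < d →
    d ≤ (restrict j (k + 1) m'' (C ∪ U)).card →
    restrict j (k + 1) m'' U = ∅ ∨ restrict j (k + 1) m'' C = ∅

namespace DyadicColouring

variable {d : ℕ} {η : ℝ}

/-- The number of elements of `S` with colour `i`. -/
def colourCount (f : ℕ → Fin d) (S : Finset ℕ) (i : Fin d) : ℕ :=
  (S.filter fun x => f x = i).card

/-- The homogeneity condition on a single collection `S` coloured by `f`. -/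
def IsBalanced (η : ℝ) (f : ℕ → Fin d) (S : Finset ℕ) : Prop :=
  (d < S.card ∧ ∀ i₁ i₂ : Fin d, η * colourCount f S i₁ ≤ (colourCount f S i₂ : ℝ)) ∨
    (S.card ≤ d ∧ ∀ i : Fin d, colourCount f S i ≤ 1)

/-- The elements of `S` in the `m`-th dyadic block of size `2 ^ h`. -/
def block (h m : ℕ) (S : Finset ℕ) : Finset ℕ :=
  S.filter fun x => x / 2 ^ h = m

/-- All dyadic blocks of `S` of size at most `2 ^ h` are balanced. -/
def BalancedUpTo (η : ℝ) (h : ℕ) (f : ℕ → Fin d) (S : Finset ℕ) : Prop :=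
  ∀ h' ≤ h, ∀ m, IsBalanced η f (block h' m S)

theorem mem_block {h m x : ℕ} {S : Finset ℕ} : x ∈ block h m S ↔ x ∈ S ∧ x / 2 ^ h = m := by
  simp [block]

theorem block_subset (h m : ℕ) (S : Finset ℕ) : block h m S ⊆ S := Finset.filter_subset _ _

theorem block_mono {h m : ℕ} {S T : Finset ℕ} (hST : S ⊆ T) : block h m S ⊆ block h m T :=
  Finset.filter_subset_filter _ hST

theorem colourCount_congr {f g : ℕ → Fin d} {S : Finset ℕ} (hfg : ∀ x ∈ S, f x = g x)
    (i : Fin d) : colourCount f S i = colourCount g S i := by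
  unfold colourCount
  congr 1
  apply Finset.filter_congr
  intro x hx
  rw [hfg x hx]

theorem IsBalanced.congr {f g : ℕ → Fin d} {S : Finset ℕ} (hf : IsBalanced η f S)
    (hfg : ∀ x ∈ S, f x = g x) : IsBalanced η g S := by
  have h := colourCount_congr hfg
  simpa only [IsBalanced, h] using hf

theorem BalancedUpTo.congr {f g : ℕ → Fin d} {S : Finset ℕ} {h : ℕ} (hf : BalancedUpTo η h f S)
    (hfg : ∀ x ∈ S, f x = g x) : BalancedUpTo η h g S := fun h' hh m =>
  (hf h' hh m).congr fun x hx => hfg x (block_subset _ _ _ hx)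

theorem colourCount_union {f : ℕ → Fin d} {S T : Finset ℕ} (hST : Disjoint S T) (i : Fin d) :
    colourCount f (S ∪ T) i = colourCount f S i + colourCount f T i := by
  unfold colourCount
  rw [Finset.filter_union, Finset.card_union_of_disjoint]
  exact Finset.disjoint_filter_filter hST

theorem sum_colourCount (f : ℕ → Fin d) (S : Finset ℕ) : ∑ i, colourCount f S i = S.card :=
  (Finset.card_eq_sum_card_fiberwise (f := f) (s := S) (t := Finset.univ) (by simp)).symm

theorem colourCount_pos_iff {f : ℕ → Fin d} {S : Finset ℕ} {i : Fin d} :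
    0 < colourCount f S i ↔ i ∈ S.image f := by
  simp [colourCount, Finset.card_pos, Finset.Nonempty]

theorem colourCount_le_one_iff {f : ℕ → Fin d} {S : Finset ℕ} :
    (∀ i, colourCount f S i ≤ 1) ↔ Set.InjOn f S := by
  simp only [colourCount, Finset.card_le_one, Finset.mem_filter]
  constructor
  · intro h x hx y hy hxy
    exact h (f y) x ⟨hx, hxy⟩ y ⟨hy, rfl⟩
  · rintro h i x ⟨hx, hxi⟩ y ⟨hy, hyi⟩
    exact h hx hy (hxi.trans hyi.symm)

theorem colourCount_of_injOn {f : ℕ → Fin d} {S : Finset ℕ} (hf : Set.InjOn f S) (i : Fin d) :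
    colourCount f S i = if i ∈ S.image f then 1 else 0 := by
  have h1 := colourCount_le_one_iff.2 hf i
  have h2 := colourCount_pos_iff (f := f) (S := S) (i := i)
  split_ifs with h
  · have := h2.2 h
    omega
  · have := mt h2.1 h
    omega

theorem IsBalanced.injOn {f : ℕ → Fin d} {S : Finset ℕ} (hf : IsBalanced η f S)
    (hS : S.card ≤ d) : Set.InjOn f S := by
  rcases hf with ⟨h, -⟩ | ⟨-, h⟩
  · omega
  · exact colourCount_le_one_iff.1 h

theorem isBalanced_of_injOn {f : ℕ → Fin d} {S : Finset ℕ} (hf : Set.InjOn f S)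
    (hS : S.card ≤ d) : IsBalanced η f S :=
  Or.inr ⟨hS, colourCount_le_one_iff.2 hf⟩

theorem balancedUpTo_of_injOn {f : ℕ → Fin d} {S : Finset ℕ} (hf : Set.InjOn f S)
    (hS : S.card ≤ d) (h : ℕ) : BalancedUpTo η h f S := fun _ _ _ =>
  isBalanced_of_injOn (hf.mono (block_subset _ _ _))
    ((Finset.card_le_card (block_subset _ _ _)).trans hS)

theorem isBalanced_empty (f : ℕ → Fin d) : IsBalanced η f ∅ :=
  isBalanced_of_injOn (by simp) (by simp)

/-- Nearly equal colour counts are balanced. -/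
theorem isBalanced_of_le_add_one (hη : η ≤ 1 / 2) {f : ℕ → Fin d} {S : Finset ℕ}
    (hf : ∀ i₁ i₂, colourCount f S i₁ ≤ colourCount f S i₂ + 1) : IsBalanced η f S := by
  have hsum := sum_colourCount f S
  rcases le_or_gt S.card d with hS | hS
  · refine Or.inr ⟨hS, fun i => ?_⟩
    by_contra! hi
    have : ∑ _k : Fin d, 1 < ∑ k, colourCount f S k :=
      Finset.sum_lt_sum (fun k _ => by have := hf i k; omega) ⟨i, Finset.mem_univ _, hi⟩
    simp at this
    omega
  · refine Or.inl ⟨hS, fun i₁ i₂ => ?_⟩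
    have hpos : 1 ≤ colourCount f S i₂ := by
      by_contra! h0
      have : ∑ k, colourCount f S k ≤ ∑ _k : Fin d, 1 :=
        Finset.sum_le_sum fun k _ => by have := hf k i₂; omega
      simp at this
      omega
    have h1 : (colourCount f S i₁ : ℝ) ≤ colourCount f S i₂ + 1 := mod_cast hf i₁ i₂
    have h2 : (1 : ℝ) ≤ colourCount f S i₂ := mod_cast hpos
    have h3 : (0 : ℝ) ≤ colourCount f S i₁ := by positivity
    nlinarith

/-- If a balanced collection has at least `d` elements, then every colour occurs and the
inequality between the colour counts holds. -/
theorem IsBalanced.of_le_card (hη0 : 0 < η) (hη : η ≤ 1 / 2) {f : ℕ → Fin d} {S : Finset ℕ}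
    (hf : IsBalanced η f S) (hS : d ≤ S.card) :
    (∀ i, 1 ≤ colourCount f S i) ∧
      ∀ i₁ i₂, η * colourCount f S i₁ ≤ (colourCount f S i₂ : ℝ) := by
  have hsum := sum_colourCount f S
  rcases hf with ⟨h, hf⟩ | ⟨h, hf⟩
  · refine ⟨fun i => ?_, hf⟩
    by_contra! h0
    have h0' : colourCount f S i = 0 := by omega
    have hz : ∀ k, colourCount f S k = 0 := by
      intro k
      have := hf k i
      rw [h0', Nat.cast_zero] at this
      have h3 : (colourCount f S k : ℝ) ≤ 0 := by
        by_contra! h4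
        have := mul_pos hη0 h4
        linarith
      exact_mod_cast le_antisymm h3 (by positivity)
    simp only [hz, Finset.sum_const_zero] at hsum
    omega
  · have h1 : ∀ i, colourCount f S i = 1 := by
      intro i
      by_contra hi
      have : ∑ k, colourCount f S k < ∑ _k : Fin d, 1 :=
        Finset.sum_lt_sum (fun k _ => hf k)
          ⟨i, Finset.mem_univ _, lt_of_le_of_ne (hf i) hi⟩
      simp at this
      omega
    refine ⟨fun i => (h1 i).ge, fun i₁ i₂ => ?_⟩
    rw [h1, h1]
    norm_num
    linarith

theorem block_block {h' h : ℕ} (hh : h' ≤ h) (m' m : ℕ) (S : Finset ℕ) :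
    block h' m' (block h m S) = if m' / 2 ^ (h - h') = m then block h' m' S else ∅ := by
  have key : ∀ x : ℕ, x / 2 ^ h = x / 2 ^ h' / 2 ^ (h - h') := by
    intro x
    rw [Nat.div_div_eq_div_mul, ← pow_add, Nat.add_sub_cancel' hh]
  ext x
  split_ifs with hm
  · simp only [mem_block, key]
    constructor
    · rintro ⟨⟨h1, -⟩, h2⟩
      exact ⟨h1, h2⟩
    · rintro ⟨h1, h2⟩
      exact ⟨⟨h1, by rw [h2, hm]⟩, h2⟩
  · simp only [mem_block, key, Finset.notMem_empty, iff_false]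
    rintro ⟨⟨h1, h3⟩, h2⟩
    rw [h2] at h3
    exact hm h3

theorem BalancedUpTo.block {f : ℕ → Fin d} {S : Finset ℕ} {h j : ℕ}
    (hf : BalancedUpTo η j f S) (hh : h ≤ j) (m : ℕ) :
    BalancedUpTo η h f (block h m S) := by
  intro h' hh' m'
  rw [block_block hh']
  split_ifs
  · exact hf h' (hh'.trans hh) m'
  · exact isBalanced_empty f

/-- The last two arguments are the positions of the two halves of the block at position `m`. -/
def AreHalves (m m' m'' : ℕ) : Prop :=
  (m' = 2 * m ∧ m'' = 2 * m + 1) ∨ (m' = 2 * m + 1 ∧ m'' = 2 * m)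

theorem AreHalves.symm {m m' m'' : ℕ} (hm : AreHalves m m' m'') : AreHalves m m'' m' := by
  unfold AreHalves at *
  tauto

theorem block_succ {m m' m'' : ℕ} (hm : AreHalves m m' m'') (h : ℕ) (S : Finset ℕ) :
    block (h + 1) m S = block h m' S ∪ block h m'' S := by
  ext x
  have : x / 2 ^ (h + 1) = x / 2 ^ h / 2 := by rw [pow_succ, Nat.div_div_eq_div_mul]
  simp only [mem_block, Finset.mem_union, this]
  unfold AreHalves at hm
  rw [← and_or_left]
  refine and_congr_right fun _ => ?_
  omega

theorem disjoint_block {m m' m'' : ℕ} (hm : AreHalves m m' m'') (h : ℕ) (S T : Finset ℕ) :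
    Disjoint (block h m' S) (block h m'' T) := by
  rw [Finset.disjoint_left]
  intro x hx hy
  rw [mem_block] at hx hy
  unfold AreHalves at hm
  omega

theorem balancedUpTo_succ {f : ℕ → Fin d} {S : Finset ℕ} {h m m' m'' : ℕ}
    (hm : AreHalves m m' m'') (hS : IsBalanced η f (block (h + 1) m S))
    (h1 : BalancedUpTo η h f (block h m' S)) (h2 : BalancedUpTo η h f (block h m'' S)) :
    BalancedUpTo η (h + 1) f (block (h + 1) m S) := by
  intro h' hh' n
  rw [block_block hh']
  split_ifs with hn
  · rcases Nat.lt_or_ge h h' with hlt | hle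
    · obtain rfl : h' = h + 1 := by omega
      simp only [Nat.sub_self, pow_zero, Nat.div_one] at hn
      rwa [hn]
    · have h3 := h1 h' hle n
      have h4 := h2 h' hle n
      rw [block_block hle] at h3 h4
      rw [show h + 1 - h' = (h - h') + 1 by omega, pow_succ, ← Nat.div_div_eq_div_mul] at hn
      unfold AreHalves at hm
      have : n / 2 ^ (h - h') = m' ∨ n / 2 ^ (h - h') = m'' := by omega
      rcases this with h5 | h5
      · rwa [if_pos h5] at h3
      · rwa [if_pos h5] at h4
  · exact isBalanced_empty f

/-- An injective colouring of `C` extends to an injective colouring of `S` with prescribed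
set of colours. -/
theorem exists_injOn_extension {C S : Finset ℕ} (hCS : C ⊆ S) {f : ℕ → Fin d}
    (hf : Set.InjOn f C) {P : Finset (Fin d)} (hP : C.image f ⊆ P) (hcard : P.card = S.card) :
    ∃ g : ℕ → Fin d, (∀ x ∈ C, g x = f x) ∧ Set.InjOn g S ∧ S.image g = P := by
  classical
  obtain ⟨e, he⟩ := Finset.exists_equiv_extend_of_card_eq (α := S) (t := P)
    (by simp [hcard]) (s := Finset.univ.filter fun x : S => (x : ℕ) ∈ C) (f := fun x => f x)
    (by
      intro i hi
      simp only [Finset.mem_image, Finset.mem_filter, Finset.mem_univ, true_and] at hi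
      obtain ⟨x, hx, rfl⟩ := hi
      exact hP (Finset.mem_image_of_mem f hx))
    (by
      intro x hx y hy hxy
      simp only [Finset.coe_filter, Finset.mem_univ, true_and, Set.mem_ofPred_eq] at hx hy
      exact Subtype.ext (hf hx hy hxy))
  let g : ℕ → Fin d := fun x => if hx : x ∈ S then (e ⟨x, hx⟩ : Fin d) else f x
  have hg : ∀ x (hx : x ∈ S), g x = e ⟨x, hx⟩ := fun x hx => dif_pos hx
  refine ⟨g, fun x hx => ?_, fun x hx y hy hxy => ?_, ?_⟩
  · rw [hg x (hCS hx)]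
    exact he _ (by simpa using hx)
  · rw [hg x hx, hg y hy] at hxy
    simpa using e.injective (Subtype.ext hxy)
  · ext i
    simp only [Finset.mem_image]
    constructor
    · rintro ⟨x, hx, rfl⟩
      rw [hg x hx]
      exact (e _).2
    · intro hi
      refine ⟨e.symm ⟨i, hi⟩, (e.symm ⟨i, hi⟩).2, ?_⟩
      rw [hg _ (e.symm ⟨i, hi⟩).2]
      simp

/-- Enlarge `A` to a set with `n` elements by adding elements with the smallest values of `c`. -/
theorem exists_superset_minimal (c : Fin d → ℕ) (A : Finset (Fin d)) (n : ℕ)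
    (hA : A.card ≤ n) (hn : n ≤ d) :
    ∃ P, A ⊆ P ∧ P.card = n ∧ ∀ i ∈ P, i ∉ A → ∀ k, k ∉ P → c i ≤ c k := by
  classical
  induction n, hA using Nat.le_induction with
  | base => exact ⟨A, subset_rfl, rfl, fun i hi hi' => absurd hi hi'⟩
  | succ n hA ih =>
    obtain ⟨P, hAP, hPn, hP⟩ := ih (by omega)
    have hne : Pᶜ.Nonempty := by
      rw [← Finset.card_pos, Finset.card_compl, Fintype.card_fin]
      omega
    obtain ⟨a, ha, hmin⟩ := Finset.exists_min_image Pᶜ c hne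
    rw [Finset.mem_compl] at ha
    refine ⟨insert a P, hAP.trans (Finset.subset_insert _ _), ?_, ?_⟩
    · rw [Finset.card_insert_of_notMem ha, hPn]
    · intro i hi hiA k hk
      rw [Finset.mem_insert, not_or] at hk
      rcases Finset.mem_insert.1 hi with rfl | hi
      · exact hmin k (by simpa using hk.2)
      · exact hP i hi hiA k hk.2

/-- Enlarge `A` and `B` to sets of given sizes which together exhaust all colours. -/
theorem exists_supersets_union_eq_univ (A B : Finset (Fin d)) (n₁ n₂ : ℕ)
    (hA : A.card ≤ n₁) (hB : B.card ≤ n₂) (h₁ : n₁ ≤ d) (h₂ : n₂ ≤ d) (hd : d ≤ n₁ + n₂)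
    (hAB : A ∪ B = Finset.univ ∨ Disjoint A B) :
    ∃ P Q : Finset (Fin d), A ⊆ P ∧ B ⊆ Q ∧ P.card = n₁ ∧ Q.card = n₂ ∧ P ∪ Q = Finset.univ := by
  classical
  have hcard : ∀ X : Finset (Fin d), Xᶜ.card = d - X.card := fun X => by
    rw [Finset.card_compl, Fintype.card_fin]
  have hle : ∀ X : Finset (Fin d), X.card ≤ d := fun X => by
    simpa using Finset.card_le_univ X
  obtain ⟨P, hAP, hPn, hPB⟩ : ∃ P : Finset (Fin d), A ⊆ P ∧ P.card = n₁ ∧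
      (B ∪ Pᶜ).card ≤ n₂ := by
    rcases hAB with hAB | hAB
    · obtain ⟨P, hAP, hP⟩ := Finset.exists_superset_card_eq hA (by simpa using h₁)
      refine ⟨P, hAP, hP, ?_⟩
      rwa [Finset.union_eq_left.2]
      intro x hx
      rw [Finset.mem_compl] at hx
      have := Finset.mem_univ x
      rw [← hAB, Finset.mem_union] at this
      exact this.resolve_left fun h => hx (hAP h)
    · have hABc : A ⊆ Bᶜ := by
        intro x hx
        rw [Finset.mem_compl]
        exact Finset.disjoint_left.1 hAB hx
      rcases le_or_gt n₁ Bᶜ.card with hn | hn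
      · obtain ⟨P, hAP, hPB, hP⟩ := Finset.exists_subsuperset_card_eq hABc hA hn
        refine ⟨P, hAP, hP, ?_⟩
        rw [Finset.union_eq_right.2, hcard]
        · omega
        · intro x hx
          rw [Finset.mem_compl]
          exact fun h => Finset.mem_compl.1 (hPB h) hx
      · obtain ⟨P, hBP, hP⟩ := Finset.exists_superset_card_eq hn.le (by simpa using h₁)
        refine ⟨P, hABc.trans hBP, hP, ?_⟩
        rwa [Finset.union_eq_left.2]
        intro x hx
        by_contra h
        exact Finset.mem_compl.1 hx (hBP (by simpa using h))
  obtain ⟨Q, hBQ, hQ⟩ := Finset.exists_superset_card_eq hPB (by simpa using h₂)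
  refine ⟨P, Q, hAP, Finset.subset_union_left.trans hBQ, hPn, hQ, ?_⟩
  ext x
  simp only [Finset.mem_union, Finset.mem_univ, iff_true]
  by_contra! h
  exact h.2 (hBQ (by simp [h.1]))

/-- Colouring the elements of `T` cyclically in increasing order. -/
theorem exists_cyclic_colouring (T : Finset ℕ) (σ : Equiv.Perm (Fin d)) (hd : 0 < d) :
    ∃ g : ℕ → Fin d, ∀ y i, colourCount g (T.filter (· < y)) i =
      (T.filter (· < y)).card / d +
        if ((σ.symm i : Fin d) : ℕ) < (T.filter (· < y)).card % d then 1 else 0 := by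
  let g : ℕ → Fin d := fun x => σ ⟨(T.filter (· < x)).card % d, Nat.mod_lt _ hd⟩
  refine ⟨g, fun y i => ?_⟩
  have key : colourCount g (T.filter (· < y)) i =
      Nat.count (· ≡ ((σ.symm i : Fin d) : ℕ) [MOD d]) (T.filter (· < y)).card := by
    induction y with
    | zero => simp [colourCount]
    | succ y ih =>
      by_cases hy : y ∈ T
      · have h1 : T.filter (· < y + 1) = T.filter (· < y) ∪ {y} := by
          ext x
          simp only [Finset.mem_filter, Finset.mem_union, Finset.mem_singleton]
          constructor
          · rintro ⟨h, h'⟩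
            rcases Nat.lt_succ_iff_lt_or_eq.1 h' with h2 | h2
            · exact Or.inl ⟨h, h2⟩
            · exact Or.inr h2
          · rintro (⟨h, h'⟩ | rfl)
            · exact ⟨h, by omega⟩
            · exact ⟨hy, by omega⟩
        have h2 : Disjoint (T.filter (· < y)) {y} := by simp
        rw [h1, colourCount_union h2, Finset.card_union_of_disjoint h2, Finset.card_singleton,
          Nat.count_succ, ih]
        congr 1
        have h3 : g y = i ↔ (T.filter (· < y)).card ≡ ((σ.symm i : Fin d) : ℕ) [MOD d] := by
          rw [Nat.ModEq, Nat.mod_eq_of_lt (σ.symm i).2, ← Equiv.eq_symm_apply, Fin.ext_iff]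
        unfold colourCount
        rw [Finset.filter_singleton]
        by_cases h4 : g y = i
        · rw [if_pos h4, if_pos (h3.1 h4), Finset.card_singleton]
        · rw [if_neg h4, if_neg (mt h3.2 h4), Finset.card_empty]
      · have h1 : T.filter (· < y + 1) = T.filter (· < y) := by
          apply Finset.filter_congr
          intro x hx
          have : x ≠ y := by
            rintro rfl
            exact hy hx
          omega
        rw [h1, ih]
  rw [key, Nat.count_modEq_card _ hd, Nat.mod_eq_of_lt (σ.symm i).2]

/-- A collection can be coloured in a balanced way at all scales, with a prescribed set `R` of
colours used once more than the others. -/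
theorem exists_balanced_colouring (hη : η ≤ 1 / 2) (hd : 0 < d) (T : Finset ℕ)
    (R : Finset (Fin d)) (hR : R.card = T.card % d) :
    ∃ g : ℕ → Fin d, (∀ h, BalancedUpTo η h g T) ∧
      ∀ i, colourCount g T i = T.card / d + if i ∈ R then 1 else 0 := by
  classical
  have hr : T.card % d < d := Nat.mod_lt _ hd
  have e : {i : Fin d // (i : ℕ) < T.card % d} ≃ {i : Fin d // i ∈ R} := by
    apply Fintype.equivOfCardEq
    rw [Fintype.card_coe, hR, Fintype.card_subtype, Fin.card_filter_val_lt, min_eq_right hr.le]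
  let σ : Equiv.Perm (Fin d) := e.extendSubtype
  have hσ : ∀ i : Fin d, ((σ.symm i : Fin d) : ℕ) < T.card % d ↔ i ∈ R := by
    intro i
    constructor
    · intro h
      simpa [σ] using e.extendSubtype_mem _ h
    · intro h
      by_contra h'
      exact e.extendSubtype_not_mem _ h' (by simpa [σ] using h)
  obtain ⟨g, hg⟩ := exists_cyclic_colouring T σ hd
  refine ⟨g, fun h h' _ m => isBalanced_of_le_add_one hη fun i₁ i₂ => ?_, fun i => ?_⟩
  · have hz : m * 2 ^ h' ≤ (m + 1) * 2 ^ h' := Nat.mul_le_mul_right _ (by omega)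
    have hdiv : ∀ x, x / 2 ^ h' = m ↔ m * 2 ^ h' ≤ x ∧ x < (m + 1) * 2 ^ h' := fun x => by
      rw [← Nat.le_div_iff_mul_le (by positivity), ← Nat.div_lt_iff_lt_mul (by positivity)]
      omega
    have hun : T.filter (· < (m + 1) * 2 ^ h') = T.filter (· < m * 2 ^ h') ∪ block h' m T := by
      ext x
      simp only [Finset.mem_union, Finset.mem_filter, mem_block, hdiv]
      rw [← and_or_left]
      refine and_congr_right fun _ => ?_
      omega
    have hdis : Disjoint (T.filter (· < m * 2 ^ h')) (block h' m T) := by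
      rw [Finset.disjoint_left]
      intro x hx hx'
      rw [mem_block, hdiv] at hx'
      have := (Finset.mem_filter.1 hx).2
      omega
    have key : ∀ i, _ := fun i => colourCount_union (f := g) hdis i
    rw [← hun] at key
    have k₁ := key i₁
    have k₂ := key i₂
    rw [hg, hg] at k₁ k₂
    split_ifs at k₁ k₂ <;> omega
  · have h1 := hg (T.sup id + 1) i
    have h2 : T.filter (· < T.sup id + 1) = T := by
      apply Finset.filter_true_of_mem
      intro x hx
      exact Nat.lt_succ_of_le (Finset.le_sup (f := id) hx)
    rw [h2] at h1
    simp only [h1, hσ]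

/-- Colouring two neighbouring collections, the first one having fewer than `d` elements. -/
theorem exists_extension_pair (hη0 : 0 < η) (hη : η ≤ 1 / 2) {h : ℕ} {f : ℕ → Fin d}
    {S₁ S₂ C₁ C₂ : Finset ℕ} (hC₁ : C₁ ⊆ S₁) (hC₂ : C₂ ⊆ S₂) (hS : Disjoint S₁ S₂)
    (hS₁ : S₁.card < d) (hcard : d < S₁.card + S₂.card)
    (hf : IsBalanced η f (C₁ ∪ C₂)) (hf₁ : IsBalanced η f C₁) (hf₂ : IsBalanced η f C₂)
    (hfh : BalancedUpTo η h f C₂) (hprev : d ≤ S₂.card → S₂ ⊆ C₂ ∨ C₂ = ∅) :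
    ∃ g₁ g₂ : ℕ → Fin d, (∀ x ∈ C₁, g₁ x = f x) ∧ (∀ x ∈ C₂, g₂ x = f x) ∧
      BalancedUpTo η h g₁ S₁ ∧ BalancedUpTo η h g₂ S₂ ∧
      ∀ i k, η * ((colourCount g₁ S₁ i + colourCount g₂ S₂ i : ℕ) : ℝ) ≤
        ((colourCount g₁ S₁ k + colourCount g₂ S₂ k : ℕ) : ℝ) := by
  classical
  have hd : 0 < d := by omega
  have hC : Disjoint C₁ C₂ := Finset.disjoint_of_subset_left hC₁
    (Finset.disjoint_of_subset_right hC₂ hS)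
  have hle₁ := Finset.card_le_card hC₁
  have hle₂ := Finset.card_le_card hC₂
  have hinj₁ : Set.InjOn f C₁ := hf₁.injOn (by omega)
  have hA : (C₁.image f).card ≤ S₁.card := Finset.card_image_le.trans hle₁
  have hhalf : ∀ a b : ℕ, a ≤ 2 * b → η * (a : ℝ) ≤ b := by
    intro a b hab
    have h1 : (a : ℝ) ≤ 2 * b := mod_cast hab
    have h2 : (0 : ℝ) ≤ a := by positivity
    nlinarith
  rcases lt_or_ge S₂.card d with hS₂ | hS₂
  · have hinj₂ : Set.InjOn f C₂ := hf₂.injOn (by omega)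
    have hAB : C₁.image f ∪ C₂.image f = Finset.univ ∨ Disjoint (C₁.image f) (C₂.image f) := by
      rcases le_or_gt (C₁ ∪ C₂).card d with hc | hc
      · right
        have hinj := hf.injOn hc
        rw [Finset.disjoint_left]
        intro i hi hi'
        obtain ⟨x, hx, rfl⟩ := Finset.mem_image.1 hi
        obtain ⟨y, hy, hxy⟩ := Finset.mem_image.1 hi'
        have := hinj (by simp [hy]) (by simp [hx]) hxy
        subst this
        exact Finset.disjoint_left.1 hC hx hy
      · left
        ext i
        rw [← Finset.image_union, ← colourCount_pos_iff]
        exact iff_of_true ((hf.of_le_card hη0 hη hc.le).1 i) (Finset.mem_univ i)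
    obtain ⟨P, Q, hAP, hBQ, hP, hQ, hPQ⟩ := exists_supersets_union_eq_univ _ _ S₁.card S₂.card hA
      (Finset.card_image_le.trans hle₂) hS₁.le hS₂.le hcard.le hAB
    obtain ⟨g₁, hg₁, hi₁, him₁⟩ := exists_injOn_extension hC₁ hinj₁ hAP hP
    obtain ⟨g₂, hg₂, hi₂, him₂⟩ := exists_injOn_extension hC₂ hinj₂ hBQ hQ
    refine ⟨g₁, g₂, hg₁, hg₂, balancedUpTo_of_injOn hi₁ hS₁.le h,
      balancedUpTo_of_injOn hi₂ hS₂.le h, fun i k => hhalf _ _ ?_⟩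
    have h1 := colourCount_le_one_iff.2 hi₁ i
    have h2 := colourCount_le_one_iff.2 hi₂ i
    have h3 : 0 < colourCount g₁ S₁ k ∨ 0 < colourCount g₂ S₂ k := by
      rw [colourCount_pos_iff, colourCount_pos_iff, him₁, him₂, ← Finset.mem_union, hPQ]
      exact Finset.mem_univ _
    omega
  · rcases hprev hS₂ with hU | hU
    · obtain rfl : S₂ = C₂ := subset_antisymm hU hC₂
      obtain ⟨hpos, hbal⟩ := hf₂.of_le_card hη0 hη hS₂
      obtain ⟨P, hAP, hP, hmin⟩ := exists_superset_minimal (colourCount f S₂) _ S₁.card hA hS₁.le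
      obtain ⟨g, hg, hi, him⟩ := exists_injOn_extension hC₁ hinj₁ hAP hP
      refine ⟨g, f, hg, fun _ _ => rfl, balancedUpTo_of_injOn hi hS₁.le h, hfh, fun i k => ?_⟩
      have hik := hbal i k
      have hk1 : (1 : ℝ) ≤ colourCount f S₂ k := mod_cast hpos k
      rw [colourCount_of_injOn hi, colourCount_of_injOn hi, him]
      by_cases hiP : i ∈ P
      · by_cases hkP : k ∈ P
        · rw [if_pos hiP, if_pos hkP]
          push_cast
          linarith
        · rw [if_pos hiP, if_neg hkP]
          push_cast
          by_cases hiA : i ∈ C₁.image f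
          · have hkA : k ∉ C₁.image f := fun hk => hkP (hAP hk)
            have hne : 0 < C₁.card := by
              rw [Finset.card_pos]
              exact Finset.image_nonempty.1 ⟨i, hiA⟩
            have hold := (hf.of_le_card hη0 hη
              (by rw [Finset.card_union_of_disjoint hC]; omega)).2 i k
            rw [colourCount_union hC, colourCount_union hC, colourCount_of_injOn hinj₁,
              colourCount_of_injOn hinj₁, if_pos hiA, if_neg hkA] at hold
            push_cast at hold
            linarith
          · have hle : (colourCount f S₂ i : ℝ) ≤ colourCount f S₂ k :=
              mod_cast hmin i hiP hiA k hkP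
            nlinarith
      · rw [if_neg hiP]
        have : (0 : ℝ) ≤ ((if k ∈ P then 1 else 0 : ℕ) : ℝ) := by positivity
        push_cast at this ⊢
        linarith
    · subst hU
      obtain ⟨P, hAP, hP⟩ := Finset.exists_superset_card_eq hA (by simpa using hS₁.le)
      obtain ⟨g, hg, hi, him⟩ := exists_injOn_extension hC₁ hinj₁ hAP hP
      have hr : S₂.card % d < d := Nat.mod_lt _ hd
      have hPc : Pᶜ.card = d - P.card := by rw [Finset.card_compl, Fintype.card_fin]
      obtain ⟨R, hR, hPR⟩ : ∃ R : Finset (Fin d), R.card = S₂.card % d ∧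
          ((∀ i ∈ R, i ∉ P) ∨ ∀ i, i ∈ R ∨ i ∈ P) := by
        rcases le_or_gt (S₂.card % d) Pᶜ.card with hn | hn
        · obtain ⟨R, hRP, hR⟩ := Finset.exists_subset_card_eq hn
          exact ⟨R, hR, Or.inl fun i hi => Finset.mem_compl.1 (hRP hi)⟩
        · obtain ⟨R, hPR, hR⟩ := Finset.exists_superset_card_eq hn.le (by simpa using hr.le)
          refine ⟨R, hR, Or.inr fun i => ?_⟩
          by_cases hi : i ∈ P
          · exact Or.inr hi
          · exact Or.inl (hPR (by simpa using hi))
      obtain ⟨g₂, hg₂, hcnt⟩ := exists_balanced_colouring hη hd S₂ R hR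
      refine ⟨g, g₂, hg, by simp, balancedUpTo_of_injOn hi hS₁.le h, hg₂ h,
        fun i k => hhalf _ _ ?_⟩
      have hq : 1 ≤ S₂.card / d := Nat.div_pos hS₂ hd
      rw [colourCount_of_injOn hi, colourCount_of_injOn hi, him, hcnt, hcnt]
      rcases hPR with hPR | hPR
      · have := hPR i
        have := hPR k
        split_ifs <;> first | omega | tauto
      · have := hPR i
        have := hPR k
        split_ifs <;> first | omega | tauto

/-- Two extensions on the halves of a block glue to an extension on the block. -/
theorem exists_extension_of_halves {C W : Finset ℕ} (hCW : C ⊆ W) {f g₁ g₂ : ℕ → Fin d}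
    {h m m' m'' : ℕ} (hm : AreHalves m m' m'') (hcard : d < (block (h + 1) m W).card)
    (h₁ : ∀ x ∈ block h m' C, g₁ x = f x) (h₂ : ∀ x ∈ block h m'' C, g₂ x = f x)
    (hb₁ : BalancedUpTo η h g₁ (block h m' W)) (hb₂ : BalancedUpTo η h g₂ (block h m'' W))
    (hcount : ∀ i k,
      η * ((colourCount g₁ (block h m' W) i + colourCount g₂ (block h m'' W) i : ℕ) : ℝ) ≤
        ((colourCount g₁ (block h m' W) k + colourCount g₂ (block h m'' W) k : ℕ) : ℝ)) :
    ∃ g : ℕ → Fin d, (∀ x ∈ block (h + 1) m C, g x = f x) ∧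
      BalancedUpTo η (h + 1) g (block (h + 1) m W) := by
  classical
  have hdis := disjoint_block hm h W W
  let g : ℕ → Fin d := fun x => if x ∈ block h m' W then g₁ x else g₂ x
  have hg₁ : ∀ x ∈ block h m' W, g₁ x = g x := fun x hx => (if_pos hx).symm
  have hg₂ : ∀ x ∈ block h m'' W, g₂ x = g x := fun x hx =>
    (if_neg (Finset.disjoint_right.1 hdis hx)).symm
  refine ⟨g, fun x hx => ?_, balancedUpTo_succ hm ?_ (hb₁.congr hg₁) (hb₂.congr hg₂)⟩
  · rw [block_succ hm, Finset.mem_union] at hx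
    rcases hx with hx | hx
    · rw [← hg₁ x (block_mono hCW hx), h₁ x hx]
    · rw [← hg₂ x (block_mono hCW hx), h₂ x hx]
  · refine Or.inl ⟨hcard, fun i k => ?_⟩
    rw [block_succ hm, colourCount_union hdis, colourCount_union hdis,
      ← colourCount_congr hg₁, ← colourCount_congr hg₂, ← colourCount_congr hg₁,
      ← colourCount_congr hg₂]
    exact hcount i k

/-- A balanced colouring of `C` extends to `W` on every block, if the extension from `C` to `W`
is previsible. -/
theorem exists_extension_block (hη0 : 0 < η) (hη : η ≤ 1 / 2) (hd : 0 < d) {j : ℕ}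
    {C W : Finset ℕ} (hCW : C ⊆ W) {f : ℕ → Fin d} (hf : BalancedUpTo η j f C)
    (hprev : ∀ h < j, ∀ m m' m'', AreHalves m m' m'' → (block h m' W).card < d →
      d ≤ (block h m'' W).card → block h m'' W ⊆ block h m'' C ∨ block h m'' C = ∅)
    (h : ℕ) (hh : h ≤ j) (m : ℕ) :
    ∃ g : ℕ → Fin d, (∀ x ∈ block h m C, g x = f x) ∧ BalancedUpTo η h g (block h m W) := by
  classical
  induction h generalizing m with
  | zero =>
    refine ⟨f, fun _ _ => rfl, balancedUpTo_of_injOn ?_ ?_ 0⟩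
    · intro x hx y hy _
      simp only [Finset.mem_coe, mem_block, pow_zero, Nat.div_one] at hx hy
      rw [hx.2, hy.2]
    · refine le_trans (Finset.card_le_one.2 fun x hx y hy => ?_) hd
      simp only [mem_block, pow_zero, Nat.div_one] at hx hy
      rw [hx.2, hy.2]
  | succ h ih =>
    rcases le_or_gt (block (h + 1) m W).card d with hc | hc
    · have hle := Finset.card_le_card (block_mono (h := h + 1) (m := m) hCW)
      have hinj := (hf (h + 1) hh m).injOn (hle.trans hc)
      obtain ⟨P, hAP, hP⟩ := Finset.exists_superset_card_eq
        (Finset.card_image_le.trans hle : ((block (h + 1) m C).image f).card ≤ _)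
        (by simpa using hc)
      obtain ⟨g, hg, hi, -⟩ := exists_injOn_extension (block_mono hCW) hinj hAP hP
      exact ⟨g, hg, balancedUpTo_of_injOn hi hc _⟩
    · have small : ∀ m' m'', AreHalves m m' m'' → (block h m' W).card < d →
          ∃ g : ℕ → Fin d, (∀ x ∈ block (h + 1) m C, g x = f x) ∧
            BalancedUpTo η (h + 1) g (block (h + 1) m W) := by
        intro m' m'' hm hlt
        have hc' := hc
        rw [block_succ hm, Finset.card_union_of_disjoint (disjoint_block hm h W W)] at hc'
        have hbal := hf (h + 1) hh m
        rw [block_succ hm] at hbal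
        obtain ⟨g₁, g₂, h₁, h₂, hb₁, hb₂, hcount⟩ := exists_extension_pair hη0 hη
          (block_mono hCW) (block_mono hCW) (disjoint_block hm h W W) hlt hc' hbal
          (hf h (by omega) m') (hf h (by omega) m'') (hf.block (by omega) m'')
          (hprev h (by omega) m m' m'' hm hlt)
        exact exists_extension_of_halves hCW hm hc h₁ h₂ hb₁ hb₂ hcount
      have hm : AreHalves m (2 * m) (2 * m + 1) := Or.inl ⟨rfl, rfl⟩
      rcases lt_or_ge (block h (2 * m) W).card d with hl | hl
      · exact small _ _ hm hl
      rcases lt_or_ge (block h (2 * m + 1) W).card d with hr | hr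
      · exact small _ _ hm.symm hr
      obtain ⟨g₁, h₁, hb₁⟩ := ih (by omega) (2 * m)
      obtain ⟨g₂, h₂, hb₂⟩ := ih (by omega) (2 * m + 1)
      have e₁ := hb₁ h le_rfl (2 * m)
      have e₂ := hb₂ h le_rfl (2 * m + 1)
      rw [block_block le_rfl, if_pos (by simp)] at e₁ e₂
      have k₁ := (e₁.of_le_card hη0 hη hl).2
      have k₂ := (e₂.of_le_card hη0 hη hr).2
      refine exists_extension_of_halves hCW hm hc h₁ h₂ hb₁ hb₂ fun i k => ?_
      have := k₁ i k
      have := k₂ i k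
      push_cast
      linarith

theorem block_eq_empty {j k m : ℕ} {S : Finset ℕ} (hS : ∀ x ∈ S, x < 2 ^ j) (hk : k ≤ j)
    (hm : 2 ^ k ≤ m) : block (j - k) m S = ∅ := by
  rw [Finset.eq_empty_iff_forall_notMem]
  intro x hx
  rw [mem_block] at hx
  have h1 : x / 2 ^ (j - k) < 2 ^ k := by
    rw [Nat.div_lt_iff_lt_mul (by positivity), ← pow_add, Nat.add_sub_cancel' hk]
    exact hS x hx.1
  omega

theorem colourCount_block (f : ℕ → Fin d) (h m : ℕ) (S : Finset ℕ) (i : Fin d) :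
    colourCount f (block h m S) i = (block h m (S.filter fun x => f x = i)).card := by
  unfold colourCount block
  rw [Finset.filter_comm]

theorem isHomogeneous_filter_iff {j : ℕ} {S : Finset ℕ} (hS : ∀ x ∈ S, x < 2 ^ j)
    (f : ℕ → Fin d) :
    IsHomogeneous j d η S (fun i => S.filter fun x => f x = i) ↔ BalancedUpTo η j f S := by
  have hbal : ∀ k m, ((d < (restrict j k m S).card ∧ ∀ i₁ i₂ : Fin d,
      η * (restrict j k m (S.filter fun x => f x = i₁)).card ≤
        ((restrict j k m (S.filter fun x => f x = i₂)).card : ℝ)) ∨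
      ((restrict j k m S).card ≤ d ∧
        ∀ i : Fin d, (restrict j k m (S.filter fun x => f x = i)).card ≤ 1)) ↔
      IsBalanced η f (block (j - k) m S) := by
    intro k m
    simp only [IsBalanced, colourCount_block]
    rfl
  simp only [IsHomogeneous, hbal]
  constructor
  · rintro ⟨-, h⟩ h' hh' m
    rcases lt_or_ge m (2 ^ (j - h')) with hm | hm
    · simpa [Nat.sub_sub_self hh'] using h (j - h') (Nat.sub_le _ _) m hm
    · have := block_eq_empty hS (Nat.sub_le j h') hm
      rw [Nat.sub_sub_self hh'] at this
      rw [this]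
      exact isBalanced_empty f
  · intro h
    refine ⟨⟨fun i => Finset.filter_subset _ _, fun i₁ i₂ hne => ?_, fun x hx => ⟨f x, by simpa⟩⟩,
      fun k _ m _ => h _ (Nat.sub_le _ _) m⟩
    rw [Finset.disjoint_left]
    intro x hx hx'
    exact hne ((Finset.mem_filter.1 hx).2.symm.trans (Finset.mem_filter.1 hx').2)

theorem exists_eq_filter_of_isColouring (hd : 0 < d) {S : Finset ℕ} {col : Fin d → Finset ℕ}
    (hcol : IsColouring d S col) :
    ∃ f : ℕ → Fin d, col = fun i => S.filter fun x => f x = i := by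
  obtain ⟨hsub, hdis, hcov⟩ := hcol
  have : Nonempty (Fin d) := ⟨⟨0, hd⟩⟩
  choose! f hf using hcov
  refine ⟨f, funext fun i => Finset.ext fun x => ?_⟩
  rw [Finset.mem_filter]
  constructor
  · intro hx
    refine ⟨hsub i hx, ?_⟩
    by_contra hne
    exact Finset.disjoint_left.1 (hdis _ _ hne) (hf x (hsub i hx)) hx
  · rintro ⟨hx, rfl⟩
    exact hf x hx

/-- Player B can answer a single previsible move. -/
theorem exists_isHomogeneous_extension (hη0 : 0 < η) (hη : η ≤ 1 / 2) (hd : 0 < d) {j : ℕ}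
    {C W : Finset ℕ} (hW : ∀ x ∈ W, x < 2 ^ j) (hCW : C ⊆ W) (hprev : Previsible j d C (W \ C))
    {col : Fin d → Finset ℕ} (hcol : IsHomogeneous j d η C col) :
    ∃ col' : Fin d → Finset ℕ, IsHomogeneous j d η W col' ∧ ∀ i, col i ⊆ col' i := by
  obtain ⟨f, rfl⟩ := exists_eq_filter_of_isColouring hd hcol.1
  have hf := (isHomogeneous_filter_iff (fun x hx => hW x (hCW hx)) f).1 hcol
  have hprev' : ∀ h < j, ∀ m m' m'', AreHalves m m' m'' → (block h m' W).card < d →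
      d ≤ (block h m'' W).card → block h m'' W ⊆ block h m'' C ∨ block h m'' C = ∅ := by
    intro h hh m m' m'' hm h₁ h₂
    have hjk : j - (j - h - 1 + 1) = h := by omega
    have hmlt : m < 2 ^ (j - h - 1) := by
      by_contra! hge
      have h2 : 2 ^ (j - h - 1 + 1) ≤ m'' := by
        rw [pow_succ]
        unfold AreHalves at hm
        omega
      have h3 := block_eq_empty hW (show j - h - 1 + 1 ≤ j by omega) h2
      rw [hjk] at h3
      rw [h3, Finset.card_empty] at h₂
      omega
    have key := hprev (j - h - 1) (by omega) m hmlt m' m'' hm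
    rw [Finset.union_sdiff_of_subset hCW] at key
    simp only [restrict, hjk] at key
    refine (key h₁ h₂).imp (fun hU x hx => ?_) id
    rw [mem_block] at hx ⊢
    refine ⟨?_, hx.2⟩
    by_contra hxC
    have : x ∈ (W \ C).filter fun i => i / 2 ^ h = m'' := by simp [hx, hxC]
    rw [hU] at this
    exact Finset.notMem_empty _ this
  obtain ⟨g, hg, hb⟩ := exists_extension_block hη0 hη hd hCW hf hprev' j le_rfl 0
  have hall : ∀ S : Finset ℕ, (∀ x ∈ S, x < 2 ^ j) → block j 0 S = S := fun S hS =>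
    Finset.filter_true_of_mem fun x hx => Nat.div_eq_of_lt (hS x hx)
  rw [hall W hW] at hb
  rw [hall C fun x hx => hW x (hCW hx)] at hg
  refine ⟨_, (isHomogeneous_filter_iff hW g).2 hb, fun i x hx => ?_⟩
  rw [Finset.mem_filter] at hx ⊢
  exact ⟨hCW hx.1, (hg x hx.1).trans hx.2⟩

end DyadicColouring

/-- **Player B wins the game along `d`-previsible moves.**
Fix `d ∈ ℕ` and `0 < η ≤ 1/2`.  Let `C(0) ⊆ C(1) ⊆ … ⊆ C(m)` be an increasing sequence of
collections in `D_j` such that for every `1 ≤ k ≤ m` the pair `(C(k-1), C(k) \ C(k-1))` is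
`d`-previsible, and let `{C_i(0) : 1 ≤ i ≤ d}` be an `(η, d)`-homogeneous colouring of
`C(0)`.  Then there is a sequence of colourings `{C_i(k) : 1 ≤ i ≤ d}`, `1 ≤ k ≤ m`, such
that for each `k` the colouring `{C_i(k)}` is an `(η, d)`-homogeneous colouring of `C(k)`
and `C_i(k-1) ⊆ C_i(k)` for all `1 ≤ i ≤ d`. -/
theorem player_B_wins_previsible_game
    (j d m : ℕ) (hd : 0 < d) (η : ℝ) (hη0 : 0 < η) (hη : η ≤ 1 / 2)
    (C : ℕ → Finset ℕ) (hCj : ∀ k ≤ m, ∀ x ∈ C k, x < 2 ^ j)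
    (hmono : ∀ k, 1 ≤ k → k ≤ m → C (k - 1) ⊆ C k)
    (hprev : ∀ k, 1 ≤ k → k ≤ m → Previsible j d (C (k - 1)) (C k \ C (k - 1)))
    (col0 : Fin d → Finset ℕ) (hcol0 : IsHomogeneous j d η (C 0) col0) :
    ∃ col : ℕ → Fin d → Finset ℕ, col 0 = col0 ∧
      ∀ k, 1 ≤ k → k ≤ m →
        IsHomogeneous j d η (C k) (col k) ∧ ∀ i, col (k - 1) i ⊆ col k i := by
  have step : ∀ k (c : Fin d → Finset ℕ), k < m → IsHomogeneous j d η (C k) c →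
      ∃ c' : Fin d → Finset ℕ, IsHomogeneous j d η (C (k + 1)) c' ∧ ∀ i, c i ⊆ c' i :=
    fun k c hk hc => DyadicColouring.exists_isHomogeneous_extension hη0 hη hd (hCj (k + 1) hk)
      (hmono (k + 1) (by omega) hk) (hprev (k + 1) (by omega) hk) hc
  choose! next hnext hsub using step
  let col : ℕ → Fin d → Finset ℕ := fun k => Nat.rec col0 next k
  have hcol : ∀ k ≤ m, IsHomogeneous j d η (C k) (col k) := by
    intro k
    induction k with
    | zero => exact fun _ => hcol0
    | succ k ih => exact fun hk => hnext k _ hk (ih (by omega))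
  refine ⟨col, rfl, fun k hk hkm => ⟨hcol k hkm, ?_⟩⟩
  obtain ⟨k, rfl⟩ := Nat.exists_eq_add_of_le' hk
  exact hsub k (col k) hkm (hcol k (by omega))
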